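/- Let d ≥ 1, C > 0, let f : ℝ^d → ℝ be continuously differentiable, and let x_1, …, x_N ∈ [0,1]^d be such that C · N^{−1/d} is an ∞-transport bound for the pair (μ_N, Lebesgue measure restricted to [0,1]^d), where μ_N = (1/N)∑_{k=1}^N δ_{x_k}. Then there is a constant c_d > 0 depending only on d such that |∫_{[0,1]^d} f(x) dx − (1/N)∑_{k=1}^N f(x_k)| ≤ c_d · C² · ‖∇f‖_{L^∞([0,1]^d)}^{(d−1)/d} · ‖∇f‖_{L^1([0,1]^d)}^{1/d} · N^{−1/d}. -/

import Mathlib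

open MeasureTheory Metric
open scoped ENNReal

noncomputable section

/-- The closed unit cube `[0,1]^d` in `ℝ^d`. -/
def unitCube (d : ℕ) : Set (EuclideanSpace ℝ (Fin d)) :=
  {x | ∀ i, x i ∈ Set.Icc (0 : ℝ) 1}

/-- The empirical measure `(1/N) ∑ δ_{x k}`. -/
def empiricalMeasure (d N : ℕ) (x : Fin N → EuclideanSpace ℝ (Fin d)) :
    Measure (EuclideanSpace ℝ (Fin d)) :=
  ((N : ℝ≥0∞))⁻¹ • ∑ k, MeasureTheory.Measure.dirac (x k)

/-- `W` is an `∞`-transport bound for `(μ, ν)`: there is a coupling of `μ` and `ν`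
which moves no mass further than `W`. -/
def IsInfTransportBound {d : ℕ} (μ ν : Measure (EuclideanSpace ℝ (Fin d))) (W : ℝ) : Prop :=
  ∃ π : Measure (EuclideanSpace ℝ (Fin d) × EuclideanSpace ℝ (Fin d)),
    π.map Prod.fst = μ ∧ π.map Prod.snd = ν ∧ π {p | W < dist p.1 p.2} = 0

abbrev EE (d : ℕ) := EuclideanSpace ℝ (Fin d)

lemma cube_eq (d : ℕ) : unitCube d = (fun x : EE d => (x.ofLp : Fin d → ℝ)) ⁻¹' (Set.Icc 0 1) := by
  ext x
  simp only [unitCube, Set.mem_ofPred_eq, Set.mem_preimage, Set.mem_Icc, Pi.le_def, Pi.zero_apply, Pi.one_apply]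
  exact forall_and

lemma cube_closed (d : ℕ) : IsClosed (unitCube d) := by
  rw [cube_eq]
  exact isClosed_Icc.preimage (PiLp.continuous_ofLp 2 _)

lemma cube_convex (d : ℕ) : Convex ℝ (unitCube d) := by
  intro x hx y hy a b ha hb hab i
  have := (convex_Icc (0:ℝ) 1) (hx i) (hy i) ha hb hab
  simpa using this

lemma cube_vol (d : ℕ) : volume (unitCube d) = 1 := by
  rw [cube_eq, (PiLp.volume_preserving_ofLp (Fin d)).measure_preimage measurableSet_Icc.nullMeasurableSet,
    Real.volume_Icc_pi]
  simp

lemma cube_dist (d : ℕ) {x y : EE d} (hx : x ∈ unitCube d) (hy : y ∈ unitCube d) :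
    ‖x - y‖ ≤ √d := by
  rw [EuclideanSpace.norm_eq]
  apply Real.sqrt_le_sqrt
  calc ∑ i, ‖(x - y) i‖ ^ 2 ≤ ∑ i : Fin d, (1:ℝ) := by
        apply Finset.sum_le_sum
        intro i _
        have h1 := hx i
        have h2 := hy i
        simp only [PiLp.sub_apply, Real.norm_eq_abs, sq_abs, Set.mem_Icc] at *
        nlinarith
    _ = d := by simp

lemma cube_compact (d : ℕ) : IsCompact (unitCube d) := by
  refine Metric.isCompact_of_isClosed_isBounded (cube_closed d) ?_
  rw [Metric.isBounded_iff]
  exact ⟨√d, fun x hx y hy => by rw [dist_eq_norm]; exact cube_dist d hx hy⟩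

lemma lint_affine (d : ℕ) (h : EE d → ℝ≥0∞) (hh : Measurable h) (a : EE d) (s : ℝ) (hs : 0 < s) :
    ∫⁻ w, h (a + s • w) = ENNReal.ofReal ((s ^ d)⁻¹) * ∫⁻ z, h z := by
  have h1 : ∫⁻ w, h (a + s • w) = ∫⁻ u, h (a + u) ∂(Measure.map (s • ·) (volume : Measure (EE d))) := by
    rw [lintegral_map (by fun_prop) (by fun_prop)]
  rw [h1, Measure.map_addHaar_smul _ hs.ne', lintegral_smul_measure, lintegral_add_left_eq_self]
  simp [abs_of_pos hs]

lemma line_bound (d : ℕ) (f : EE d → ℝ) (hf : ContDiff ℝ 1 f) (b v : EE d) :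
    ENNReal.ofReal |f (b + v) - f b| ≤
      ENNReal.ofReal ‖v‖ * ∫⁻ t in Set.Icc (0:ℝ) 1, ‖fderiv ℝ f (b + t • v)‖ₑ := by
  have hc : Continuous (fderiv ℝ f) := hf.continuous_fderiv (by norm_num)
  have hd : ∀ t : ℝ, HasDerivAt (fun t : ℝ => f (b + t • v)) (fderiv ℝ f (b + t • v) v) t := by
    intro t
    have h1 := (hf.differentiable (by norm_num) (b + t • v)).hasFDerivAt
    have h2 : HasDerivAt (fun t : ℝ => b + t • v) v t := by
      simpa using ((hasDerivAt_id t).smul_const v).const_add b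
    exact h1.comp_hasDerivAt t h2
  have hcont : Continuous fun t : ℝ => fderiv ℝ f (b + t • v) v := by fun_prop
  have := intervalIntegral.integral_eq_sub_of_hasDerivAt (a := 0) (b := 1) (fun t _ => hd t)
    (hcont.intervalIntegrable _ _)
  simp only [one_smul, zero_smul, add_zero] at this
  rw [← this, ← Real.enorm_eq_ofReal_abs, intervalIntegral.integral_of_le zero_le_one]
  refine (enorm_integral_le_lintegral_enorm _).trans ?_
  rw [restrict_Ioc_eq_restrict_Icc, ← lintegral_const_mul' _ _ ENNReal.ofReal_ne_top]
  apply lintegral_mono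
  intro t
  refine (ContinuousLinearMap.le_opENorm _ _).trans ?_
  rw [mul_comm, ofReal_norm]

lemma morrey (d : ℕ) (hd : 1 ≤ d) (f : EE d → ℝ) (hf : ContDiff ℝ 1 f) (L W : ℝ)
    (hL : ∀ y ∈ unitCube d, ‖fderiv ℝ f y‖ ≤ L) (x y : EE d)
    (hx : x ∈ unitCube d) (hy : y ∈ unitCube d) (hxy : dist x y ≤ W) :
    ENNReal.ofReal (|f y - f x| ^ d) ≤ ENNReal.ofReal ((4 * √d) ^ d * L ^ (d - 1)) *
      ∫⁻ z in unitCube d ∩ closedBall y (2 * W), ‖fderiv ℝ f z‖ₑ := by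
  set D := |f y - f x| with hD
  set M : ℝ := √d with hM
  have hM1 : 1 ≤ M := by rw [hM]; exact Real.one_le_sqrt.mpr (by exact_mod_cast hd)
  have hL0 : 0 ≤ L := (norm_nonneg _).trans (hL x hx)
  have hlip : ∀ a ∈ unitCube d, ∀ b ∈ unitCube d, |f b - f a| ≤ L * ‖b - a‖ := by
    intro a ha b hb
    have := (cube_convex d).norm_image_sub_le_of_norm_fderiv_le (𝕜 := ℝ) (f := f)
      (fun z _ => hf.differentiable (by norm_num) z) hL ha hb
    simpa using this
  rcases (abs_nonneg (f y - f x)).eq_or_lt with h0 | hDpos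
  · rw [hD, ← h0, zero_pow (by omega)]; simp
  rw [← hD] at hDpos
  have hDL : D ≤ L * ‖y - x‖ := hlip x hx y hy
  have hvM : ‖y - x‖ ≤ M := cube_dist d hy hx
  have hLpos : 0 < L := by
    rcases hL0.eq_or_lt with h | h
    · rw [← h] at hDL; simp at hDL; linarith
    · exact h
  have hv : 0 < ‖y - x‖ := by
    by_contra h
    have : ‖y - x‖ = 0 := le_antisymm (not_lt.mp h) (norm_nonneg _)
    rw [this] at hDL; simp at hDL; linarith
  set v := y - x with hvdef
  set s : ℝ := D / (4 * L * M) with hs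
  have hspos : 0 < s := by positivity
  have hsD : D = 4 * L * M * s := by rw [hs]; field_simp
  have hsM : s * M ≤ ‖v‖ / 4 := by
    have h : 4 * L * (s * M) ≤ L * ‖v‖ := by nlinarith
    have h' : L * (4 * (s * M)) ≤ L * ‖v‖ := by linarith
    have := le_of_mul_le_mul_left h' hLpos
    linarith
  have hs4 : s ≤ 1 / 4 := by nlinarith
  have hvW : ‖v‖ ≤ W := by rw [hvdef, ← dist_eq_norm, dist_comm]; exact hxy
  set g : EE d → ℝ≥0∞ := fun z => ‖fderiv ℝ f z‖ₑ with hg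
  have hgc : Continuous (fderiv ℝ f) := hf.continuous_fderiv (by norm_num)
  have hgm : Measurable g := hgc.enorm.measurable
  set B := unitCube d ∩ closedBall y (2 * W) with hB
  have hBm : MeasurableSet B := (cube_closed d).measurableSet.inter measurableSet_closedBall
  set A : ℝ → EE d := fun t => (1 - s) • (x + t • v) with hA
  have hAc : Continuous A := by fun_prop
  -- the swept set
  set S : Set (ℝ × EE d) := {p | s⁻¹ • (p.2 - A p.1) ∈ unitCube d} with hS
  have hSc : IsClosed S := (cube_closed d).preimage (by fun_prop)
  have hSm : MeasurableSet S := hSc.measurableSet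
  -- points of the swept set
  have hmem : ∀ t ∈ Set.Icc (0:ℝ) 1, ∀ w ∈ unitCube d, A t + s • w ∈ B := by
    intro t ht w hw
    have hxt : x + t • v ∈ unitCube d := by
      have := (cube_convex d) hx hy (a := 1 - t) (b := t) (by linarith [ht.2]) ht.1 (by ring)
      convert this using 1
      rw [hvdef]; module
    refine ⟨(cube_convex d) hxt hw (by linarith) hspos.le (by ring), ?_⟩
    rw [mem_closedBall, dist_eq_norm]
    have e : A t + s • w - y = -((1 - t) • v) + s • (w - (x + t • v)) := by
      rw [hA, hvdef]; module
    rw [e]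
    refine (norm_add_le _ _).trans ?_
    rw [norm_neg, norm_smul, norm_smul, Real.norm_of_nonneg hspos.le,
      Real.norm_of_nonneg (by linarith [ht.2])]
    have h1 : (1 - t) * ‖v‖ ≤ ‖v‖ := by nlinarith [ht.1]
    have h2 : s * ‖w - (x + t • v)‖ ≤ s * M :=
      mul_le_mul_of_nonneg_left (cube_dist d hw hxt) hspos.le
    linarith
  have hlow : ∀ w ∈ unitCube d, ENNReal.ofReal (D / 2) ≤
      ENNReal.ofReal ‖v‖ * ∫⁻ t in Set.Icc (0:ℝ) 1, g (A t + s • w) := by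
    intro w hw
    have hb : (1 - s) • x + s • w ∈ unitCube d :=
      (cube_convex d) hx hw (by linarith) hspos.le (by ring)
    have hb' : (1 - s) • y + s • w ∈ unitCube d :=
      (cube_convex d) hy hw (by linarith) hspos.le (by ring)
    have h1 := hlip x hx _ hb
    have h2 := hlip y hy _ hb'
    have e1 : (1 - s) • x + s • w - x = s • (w - x) := by module
    have e2 : (1 - s) • y + s • w - y = s • (w - y) := by module
    rw [e1, norm_smul, Real.norm_of_nonneg hspos.le] at h1
    rw [e2, norm_smul, Real.norm_of_nonneg hspos.le] at h2
    have h3 : L * (s * ‖w - x‖) ≤ D / 4 := by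
      have : s * ‖w - x‖ ≤ s * M := mul_le_mul_of_nonneg_left (cube_dist d hw hx) hspos.le
      have := mul_le_mul_of_nonneg_left this hL0
      linarith
    have h4 : L * (s * ‖w - y‖) ≤ D / 4 := by
      have : s * ‖w - y‖ ≤ s * M := mul_le_mul_of_nonneg_left (cube_dist d hw hy) hspos.le
      have := mul_le_mul_of_nonneg_left this hL0
      linarith
    have h5 := line_bound d f hf ((1 - s) • x + s • w) ((1 - s) • v)
    have e3 : (1 - s) • x + s • w + (1 - s) • v = (1 - s) • y + s • w := by
      rw [hvdef]; module
    rw [e3] at h5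
    have h6 : D / 2 ≤ |f ((1 - s) • y + s • w) - f ((1 - s) • x + s • w)| := by
      set p := f ((1 - s) • y + s • w)
      set q := f ((1 - s) • x + s • w)
      have : D ≤ |f y - p| + |p - q| + |q - f x| := by
        rw [hD]
        have e : f y - f x = (f y - p) + (p - q) + (q - f x) := by ring
        rw [e]
        exact abs_add_three _ _ _
      rw [abs_sub_comm (f y) p] at this
      linarith
    refine (ENNReal.ofReal_le_ofReal h6).trans (h5.trans ?_)
    refine mul_le_mul' (ENNReal.ofReal_le_ofReal ?_) (le_of_eq ?_)
    · rw [norm_smul, Real.norm_of_nonneg (by linarith)]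
      nlinarith
    · refine lintegral_congr fun t => ?_
      have : (1 - s) • x + s • w + t • (1 - s) • v = A t + s • w := by
        rw [hA]; module
      rw [this]
  have hchange : ∀ t ∈ Set.Icc (0:ℝ) 1, ∫⁻ w in unitCube d, g (A t + s • w) ≤
      ENNReal.ofReal ((s ^ d)⁻¹) * ∫⁻ z in B, S.indicator (fun p => g p.2) (t, z) := by
    intro t ht
    have hSt : Measurable fun z : EE d => S.indicator (fun p => g p.2) (t, z) := by
      have : Measurable (S.indicator (fun p : ℝ × EE d => g p.2)) :=
        (hgm.comp measurable_snd).indicator hSm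
      exact this.comp (by fun_prop)
    rw [← lintegral_indicator hBm, ← lint_affine d _ (hSt.indicator hBm) (A t) s hspos,
      ← lintegral_indicator (cube_closed d).measurableSet]
    apply lintegral_mono
    intro w
    by_cases hw : w ∈ unitCube d
    · have hS' : (t, A t + s • w) ∈ S := by
        change s⁻¹ • (A t + s • w - A t) ∈ unitCube d
        rw [add_sub_cancel_left, smul_smul, inv_mul_cancel₀ hspos.ne', one_smul]
        exact hw
      simp only [Set.indicator_of_mem hw, Set.indicator_of_mem (hmem t ht w hw),
        Set.indicator_of_mem hS']
      exact le_rfl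
    · simp only [Set.indicator_of_notMem hw]
      exact zero_le
  have hlen : ∀ z : EE d, ∫⁻ t in Set.Icc (0:ℝ) 1, S.indicator (fun p => g p.2) (t, z) ≤
      ENNReal.ofReal (2 * s * M / ‖v‖) * g z := by
    intro z
    set T : Set ℝ := {t | (t, z) ∈ S} with hT
    have hTm : MeasurableSet T := hSm.preimage (by fun_prop : Measurable fun t : ℝ => (t, z))
    have e : ∀ t, S.indicator (fun p => g p.2) (t, z) = T.indicator (fun _ => g z) t := by
      intro t
      by_cases h : (t, z) ∈ S
      · rw [Set.indicator_of_mem h, Set.indicator_of_mem (show t ∈ T from h)]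
      · rw [Set.indicator_of_notMem h, Set.indicator_of_notMem (show t ∉ T from h)]
    refine (setLIntegral_le_lintegral _ _).trans ?_
    simp_rw [e]
    rw [lintegral_indicator hTm, setLIntegral_const, mul_comm]
    gcongr
    refine (Real.volume_le_diam _).trans ?_
    apply Metric.ediam_le
    intro t ht t' ht'
    rw [edist_dist]
    apply ENNReal.ofReal_le_ofReal
    have h1 : s⁻¹ • (z - A t) ∈ unitCube d := ht
    have h2 : s⁻¹ • (z - A t') ∈ unitCube d := ht'
    have h3 := cube_dist d h2 h1
    have e : s⁻¹ • (z - A t') - s⁻¹ • (z - A t) = (s⁻¹ * (1 - s) * (t - t')) • v := by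
      rw [hA]; module
    rw [e, norm_smul, norm_mul, Real.norm_of_nonneg (mul_nonneg (by positivity) (by linarith)),
      ← dist_eq_norm, ← hM] at h3
    rw [le_div_iff₀ hv]
    have h4 : (1 - s) * (dist t t' * ‖v‖) ≤ s * M := by
      have := mul_le_mul_of_nonneg_left h3 hspos.le
      have e2 : s * (s⁻¹ * (1 - s) * dist t t' * ‖v‖) = (1 - s) * (dist t t' * ‖v‖) := by
        field_simp
      linarith
    have : 0 ≤ dist t t' * ‖v‖ := by positivity
    nlinarith
  have hGm : Measurable (S.indicator (fun p : ℝ × EE d => g p.2)) :=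
    (hgm.comp measurable_snd).indicator hSm
  have hmain : ENNReal.ofReal (D / 2) ≤
      ENNReal.ofReal ‖v‖ * (ENNReal.ofReal ((s ^ d)⁻¹) *
        (ENNReal.ofReal (2 * s * M / ‖v‖) * ∫⁻ z in B, g z)) := by
    calc ENNReal.ofReal (D / 2) = ∫⁻ w in unitCube d, ENNReal.ofReal (D / 2) := by
          rw [setLIntegral_const, cube_vol, mul_one]
      _ ≤ ∫⁻ w in unitCube d, ENNReal.ofReal ‖v‖ * ∫⁻ t in Set.Icc (0:ℝ) 1, g (A t + s • w) :=
          setLIntegral_mono' (cube_closed d).measurableSet hlow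
      _ = ENNReal.ofReal ‖v‖ * ∫⁻ w in unitCube d, ∫⁻ t in Set.Icc (0:ℝ) 1, g (A t + s • w) :=
          lintegral_const_mul' _ _ ENNReal.ofReal_ne_top
      _ = ENNReal.ofReal ‖v‖ * ∫⁻ t in Set.Icc (0:ℝ) 1, ∫⁻ w in unitCube d, g (A t + s • w) := by
          rw [lintegral_lintegral_swap]
          exact (hgm.comp (by fun_prop : Measurable
            fun p : EE d × ℝ => A p.2 + s • p.1)).aemeasurable
      _ ≤ ENNReal.ofReal ‖v‖ * ∫⁻ t in Set.Icc (0:ℝ) 1, ENNReal.ofReal ((s ^ d)⁻¹) *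
            ∫⁻ z in B, S.indicator (fun p => g p.2) (t, z) := by
          gcongr 1
          exact setLIntegral_mono' measurableSet_Icc hchange
      _ = ENNReal.ofReal ‖v‖ * (ENNReal.ofReal ((s ^ d)⁻¹) * ∫⁻ t in Set.Icc (0:ℝ) 1,
            ∫⁻ z in B, S.indicator (fun p => g p.2) (t, z)) := by
          rw [lintegral_const_mul' _ _ ENNReal.ofReal_ne_top]
      _ = ENNReal.ofReal ‖v‖ * (ENNReal.ofReal ((s ^ d)⁻¹) * ∫⁻ z in B, ∫⁻ t in Set.Icc (0:ℝ) 1,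
            S.indicator (fun p => g p.2) (t, z)) := by
          rw [lintegral_lintegral_swap]
          exact hGm.aemeasurable
      _ ≤ ENNReal.ofReal ‖v‖ * (ENNReal.ofReal ((s ^ d)⁻¹) * ∫⁻ z in B,
            ENNReal.ofReal (2 * s * M / ‖v‖) * g z) := by
          gcongr 2
          exact lintegral_mono fun z => hlen z
      _ = _ := by
          rw [lintegral_const_mul' _ _ ENNReal.ofReal_ne_top]
  have hDd : D ^ d = (2 * D ^ (d - 1)) * (D / 2) := by
    obtain ⟨n, rfl⟩ : ∃ n, d = n + 1 := ⟨d - 1, by omega⟩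
    rw [Nat.add_sub_cancel, pow_succ]; ring
  rw [hDd, ENNReal.ofReal_mul (by positivity)]
  refine (mul_le_mul_right hmain _).trans (le_of_eq ?_)
  rw [← mul_assoc, ← mul_assoc, ← mul_assoc, ← ENNReal.ofReal_mul (by positivity),
    ← ENNReal.ofReal_mul (by positivity), ← ENNReal.ofReal_mul (by positivity)]
  congr 2
  obtain ⟨n, rfl⟩ : ∃ n, d = n + 1 := ⟨d - 1, by omega⟩
  rw [Nat.add_sub_cancel, hsD]
  clear_value s M
  field_simp
  ring

lemma sup_bound (d : ℕ) (f : EE d → ℝ) (hf : ContDiff ℝ 1 f) :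
    ∀ y ∈ unitCube d, ‖fderiv ℝ f y‖ ≤ ⨆ y ∈ unitCube d, ‖fderiv ℝ f y‖ := by
  have hgc : Continuous (fderiv ℝ f) := hf.continuous_fderiv (by norm_num)
  obtain ⟨R, hR⟩ := (cube_compact d).exists_bound_of_continuousOn hgc.continuousOn
  intro y hy
  have hbdd : BddAbove (Set.range fun y => ⨆ (_ : y ∈ unitCube d), ‖fderiv ℝ f y‖) := by
    refine ⟨max R 0, ?_⟩
    rintro _ ⟨z, rfl⟩
    exact Real.iSup_le (fun h => (hR z h).trans (le_max_left _ _)) (le_max_right _ _)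
  refine le_ciSup_of_le hbdd y ?_
  rw [ciSup_pos hy]

lemma lint_J (d : ℕ) (g : EE d → ℝ≥0∞) (hg : Measurable g) (R : ℝ) :
    Measurable (fun y => ∫⁻ z in unitCube d ∩ closedBall y R, g z) ∧
    ∫⁻ y in unitCube d, ∫⁻ z in unitCube d ∩ closedBall y R, g z ≤
      volume (closedBall (0 : EE d) R) * ∫⁻ z in unitCube d, g z := by
  set S : Set (EE d × EE d) := {p | dist p.2 p.1 ≤ R} with hS
  have hSm : MeasurableSet S :=
    (isClosed_le (by fun_prop) continuous_const).measurableSet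
  have hGm : Measurable (S.indicator (fun p : EE d × EE d => g p.2)) :=
    (hg.comp measurable_snd).indicator hSm
  have e : ∀ y, ∫⁻ z in unitCube d ∩ closedBall y R, g z =
      ∫⁻ z in unitCube d, S.indicator (fun p => g p.2) (y, z) := by
    intro y
    rw [Set.inter_comm, ← Measure.restrict_restrict measurableSet_closedBall,
      ← lintegral_indicator measurableSet_closedBall]
    rfl
  simp_rw [e]
  refine ⟨hGm.lintegral_prod_right', ?_⟩
  rw [lintegral_lintegral_swap (f := fun y z => S.indicator (fun p => g p.2) (y, z))
      hGm.aemeasurable, ← lintegral_const_mul' _ _ measure_closedBall_lt_top.ne]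
  apply lintegral_mono
  intro z
  refine (setLIntegral_le_lintegral _ _).trans ?_
  have e2 : ∀ y, S.indicator (fun p => g p.2) (y, z) = (closedBall z R).indicator (fun _ => g z) y := by
    intro y
    by_cases h : dist z y ≤ R
    · rw [Set.indicator_of_mem (show (y, z) ∈ S from h),
        Set.indicator_of_mem (by rw [mem_closedBall, dist_comm]; exact h)]
    · rw [Set.indicator_of_notMem (show (y, z) ∉ S from h),
        Set.indicator_of_notMem (by rw [mem_closedBall, dist_comm]; exact h)]
  simp_rw [e2]
  rw [lintegral_indicator measurableSet_closedBall, setLIntegral_const, mul_comm,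
    Measure.addHaar_closedBall_center]

set_option maxHeartbeats 1000000

theorem stmt14 (d : ℕ) (hd : 1 ≤ d) :
    ∃ c : ℝ, 0 < c ∧
      ∀ (C : ℝ), 0 < C →
      ∀ (f : EuclideanSpace ℝ (Fin d) → ℝ), ContDiff ℝ 1 f →
      ∀ (N : ℕ), 0 < N →
      ∀ (x : Fin N → EuclideanSpace ℝ (Fin d)), (∀ k, x k ∈ unitCube d) →
      IsInfTransportBound (empiricalMeasure d N x) (volume.restrict (unitCube d))
        (C * (N : ℝ) ^ (-(1 : ℝ) / d)) →
      |(∫ y in unitCube d, f y) - (1 / N : ℝ) * ∑ k, f (x k)| ≤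
        c * C ^ 2 * (⨆ y ∈ unitCube d, ‖fderiv ℝ f y‖) ^ (((d : ℝ) - 1) / d) *
          (∫ y in unitCube d, ‖fderiv ℝ f y‖) ^ ((1 : ℝ) / d) *
          (N : ℝ) ^ (-(1 : ℝ) / d) := by
  set ω : ℝ := (volume (ball (0 : EE d) 1)).toReal with hω
  have hωt : volume (ball (0 : EE d) 1) ≠ ⊤ := measure_ball_lt_top.ne
  have hωpos : 0 < ω := ENNReal.toReal_pos (measure_ball_pos _ _ one_pos).ne' hωt
  have hωe : volume (ball (0 : EE d) 1) = ENNReal.ofReal ω := (ENNReal.ofReal_toReal hωt).symm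
  have hd0 : d ≠ 0 := by omega
  have hdR : (0:ℝ) < d := by exact_mod_cast hd
  have hball : ∀ (a : EE d) (r : ℝ), 0 ≤ r → volume (closedBall a r) = ENNReal.ofReal (r ^ d * ω) := by
    intro a r hr
    rw [Measure.addHaar_closedBall _ _ hr, hωe, ENNReal.ofReal_mul (by positivity)]
    simp
  set K : ℝ := (4 * √d) ^ d with hK
  have hKpos : 0 < K := by positivity
  refine ⟨(K * ω ^ 2 * 2 ^ d) ^ ((1:ℝ) / d), by positivity, ?_⟩
  intro C hC f hf N hN x hx ⟨π, h1, h2, h3⟩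
  set W : ℝ := C * (N : ℝ) ^ (-(1 : ℝ) / d) with hW
  have hNR : (0:ℝ) < N := by exact_mod_cast hN
  have hWpos : 0 < W := by positivity
  set L : ℝ := ⨆ y ∈ unitCube d, ‖fderiv ℝ f y‖ with hLdef
  set I : ℝ := ∫ y in unitCube d, ‖fderiv ℝ f y‖ with hI
  have hgc : Continuous (fderiv ℝ f) := hf.continuous_fderiv (by norm_num)
  have hL := sup_bound d f hf
  rw [← hLdef] at hL
  have hL0 : 0 ≤ L := (norm_nonneg _).trans (hL _ (hx ⟨0, hN⟩))
  have hI0 : 0 ≤ I := integral_nonneg fun _ => norm_nonneg _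
  have hIe : ∫⁻ y in unitCube d, ‖fderiv ℝ f y‖ₑ = ENNReal.ofReal I := by
    rw [hI, ofReal_integral_eq_lintegral_ofReal]
    · simp_rw [ofReal_norm]
    · exact (hgc.norm.continuousOn).integrableOn_compact (cube_compact d)
    · exact Filter.Eventually.of_forall fun _ => norm_nonneg _
  have hrpow : ∀ a : ℝ, 0 ≤ a → ∀ b : ℝ, (a ^ (b / d)) ^ d = a ^ b := by
    intro a ha b
    rw [← Real.rpow_mul_natCast ha, div_mul_cancel₀ _ hdR.ne']
  have hWd : W ^ d = C ^ d * (N:ℝ)⁻¹ := by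
    rw [hW, mul_pow, hrpow _ hNR.le, Real.rpow_neg_one]
  -- the coupling is a probability measure
  have hprob : IsProbabilityMeasure π := by
    constructor
    have : π.map Prod.snd Set.univ = 1 := by rw [h2]; simp [cube_vol]
    rwa [Measure.map_apply measurable_snd MeasurableSet.univ, Set.preimage_univ] at this
  have hcubem : MeasurableSet (unitCube d) := (cube_closed d).measurableSet
  have hae2 : ∀ᵐ p ∂π, p.2 ∈ unitCube d := by
    have : ∀ᵐ y ∂(π.map Prod.snd), y ∈ unitCube d := by
      rw [h2]; exact ae_restrict_mem hcubem
    exact ae_of_ae_map measurable_snd.aemeasurable this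
  have hae1 : ∀ᵐ p ∂π, p.1 ∈ Set.range x := by
    have : ∀ᵐ y ∂(π.map Prod.fst), y ∈ Set.range x := by
      rw [h1, empiricalMeasure, ae_iff, Measure.smul_apply, Measure.finsetSum_apply]
      have hm : MeasurableSet {a | a ∉ Set.range x} := (Set.finite_range x).measurableSet.compl
      simp [Measure.dirac_apply' _ hm]
    exact ae_of_ae_map measurable_fst.aemeasurable this
  have hae3 : ∀ᵐ p ∂π, dist p.1 p.2 ≤ W := by
    rw [ae_iff]; simpa using h3
  -- lower bound for `C`
  have hClow : 1 ≤ C ^ d * ω := by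
    have hcov : unitCube d ≤ᵐ[volume] ⋃ k, closedBall (x k) W := by
      have hm : MeasurableSet (⋃ k, closedBall (x k) W) :=
        MeasurableSet.iUnion fun _ => measurableSet_closedBall
      have : ∀ᵐ y ∂(volume.restrict (unitCube d)), y ∈ ⋃ k, closedBall (x k) W := by
        rw [← h2]
        refine (ae_map_iff (p := fun y => y ∈ ⋃ k, closedBall (x k) W)
          measurable_snd.aemeasurable hm).mpr ?_
        filter_upwards [hae1, hae3] with p ⟨k, hk⟩ hp
        refine Set.mem_iUnion.mpr ⟨k, ?_⟩
        rw [mem_closedBall, hk, dist_comm]; exact hp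
      exact (ae_restrict_iff' hcubem).mp this
    have := (measure_mono_ae hcov).trans (measure_iUnion_le _)
    rw [cube_vol, tsum_fintype] at this
    simp_rw [hball _ _ hWpos.le] at this
    rw [Finset.sum_const, Finset.card_univ, Fintype.card_fin, nsmul_eq_mul,
      ← ENNReal.ofReal_natCast, ← ENNReal.ofReal_mul hNR.le, ENNReal.one_le_ofReal, hWd] at this
    calc 1 ≤ _ := this
      _ = _ := by field_simp
  -- error as integral over the coupling
  have hfc : Continuous f := hf.continuous
  have hi2 : ∫ y in unitCube d, f y = ∫ p, f p.2 ∂π := by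
    rw [← h2, integral_map measurable_snd.aemeasurable hfc.aestronglyMeasurable]
  have hi1 : (1 / N : ℝ) * ∑ k, f (x k) = ∫ p, f p.1 ∂π := by
    rw [← integral_map (f := f) measurable_fst.aemeasurable hfc.aestronglyMeasurable, h1,
      empiricalMeasure, integral_smul_measure, integral_finsetSum_measure]
    · simp
    · intro i _
      exact integrable_dirac (by simp)
  obtain ⟨R, hR⟩ := (cube_compact d).exists_bound_of_continuousOn hfc.continuousOn
  have hint2 : Integrable (fun p => f p.2) π := by
    refine Integrable.of_bound (hfc.comp continuous_snd).aestronglyMeasurable R ?_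
    filter_upwards [hae2] with p hp using hR _ hp
  have hint1 : Integrable (fun p => f p.1) π := by
    refine Integrable.of_bound (hfc.comp continuous_fst).aestronglyMeasurable R ?_
    filter_upwards [hae1] with p ⟨k, hk⟩
    rw [← hk]; exact hR _ (hx k)
  rw [hi2, hi1, ← integral_sub hint2 hint1]
  set E : ℝ := |∫ p, (f p.2 - f p.1) ∂π| with hE
  have hcm : Continuous fun p : EE d × EE d => f p.2 - f p.1 := by fun_prop
  have hEd : E ^ d ≤ K * L ^ (d - 1) * ((2 * W) ^ d * ω * I) := by
    rw [← ENNReal.ofReal_le_ofReal_iff (by positivity)]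
    have hjen : ENNReal.ofReal E ≤ (∫⁻ p, ‖f p.2 - f p.1‖ₑ ^ (d:ℝ) ∂π) ^ (1 / (d:ℝ)) := by
      rw [hE, ← Real.enorm_eq_ofReal_abs]
      refine (enorm_integral_le_lintegral_enorm _).trans ?_
      have := eLpNorm'_le_eLpNorm'_of_exponent_le (p := 1) (q := d) one_pos
        (by exact_mod_cast hd) π hcm.aestronglyMeasurable
      simpa [eLpNorm'] using this
    have hjen2 : ENNReal.ofReal (E ^ d) ≤ ∫⁻ p, ‖f p.2 - f p.1‖ₑ ^ (d:ℝ) ∂π := by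
      rw [ENNReal.ofReal_pow (abs_nonneg _), ← ENNReal.rpow_natCast]
      refine (ENNReal.rpow_le_rpow hjen hdR.le).trans ?_
      rw [← ENNReal.rpow_mul, one_div_mul_cancel hdR.ne', ENNReal.rpow_one]
    refine hjen2.trans ?_
    obtain ⟨hJm, hJ⟩ := lint_J d (fun z => ‖fderiv ℝ f z‖ₑ) hgc.enorm.measurable (2 * W)
    calc ∫⁻ p, ‖f p.2 - f p.1‖ₑ ^ (d:ℝ) ∂π
        ≤ ∫⁻ p, ENNReal.ofReal (K * L ^ (d - 1)) *
            (∫⁻ z in unitCube d ∩ closedBall p.2 (2 * W), ‖fderiv ℝ f z‖ₑ) ∂π := by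
          apply lintegral_mono_ae
          filter_upwards [hae1, hae2, hae3] with p ⟨k, hk⟩ hp2 hp3
          have := morrey d hd f hf L W hL p.1 p.2 (hk ▸ hx k) hp2 hp3
          rwa [ENNReal.ofReal_pow (abs_nonneg _), ← Real.enorm_eq_ofReal_abs,
            ← ENNReal.rpow_natCast] at this
      _ = ENNReal.ofReal (K * L ^ (d - 1)) *
            ∫⁻ p, (∫⁻ z in unitCube d ∩ closedBall p.2 (2 * W), ‖fderiv ℝ f z‖ₑ) ∂π :=
          lintegral_const_mul' _ _ ENNReal.ofReal_ne_top
      _ = ENNReal.ofReal (K * L ^ (d - 1)) * ∫⁻ y in unitCube d,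
            ∫⁻ z in unitCube d ∩ closedBall y (2 * W), ‖fderiv ℝ f z‖ₑ := by
          rw [← h2, lintegral_map hJm measurable_snd]
      _ ≤ ENNReal.ofReal (K * L ^ (d - 1)) * (ENNReal.ofReal ((2 * W) ^ d * ω) *
            ENNReal.ofReal I) := by
          rw [← hIe, ← hball 0 _ (by positivity)]
          gcongr 1
      _ = _ := by
          rw [← ENNReal.ofReal_mul (by positivity), ← ENNReal.ofReal_mul (by positivity)]
  rw [← pow_le_pow_iff_left₀ (abs_nonneg _) (by positivity) hd0]
  refine hEd.trans ?_
  have hLd : L ^ ((d:ℝ) - 1) = L ^ (d - 1) := by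
    rw [← Real.rpow_natCast, Nat.cast_sub hd, Nat.cast_one]
  rw [mul_pow 2 W, hWd]
  simp only [mul_pow _ _ d]
  rw [hrpow _ (by positivity), hrpow _ hL0, hrpow _ hI0,
    hrpow _ hNR.le, hLd, Real.rpow_one, Real.rpow_one, Real.rpow_neg_one]
  have hP : 0 ≤ K * L ^ (d - 1) * 2 ^ d * C ^ d * (N:ℝ)⁻¹ * ω * I := by positivity
  calc _ = K * L ^ (d - 1) * 2 ^ d * C ^ d * (N:ℝ)⁻¹ * ω * I * 1 := by ring
    _ ≤ K * L ^ (d - 1) * 2 ^ d * C ^ d * (N:ℝ)⁻¹ * ω * I * (C ^ d * ω) :=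
        mul_le_mul_of_nonneg_left hClow hP
    _ = _ := by ring
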